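/- Let X be an i.i.d. source with per-letter probability mass function P_X on a countable alphabet 𝒳, finite entropy H(X) = E[−log_K P_X(X)], and finite, strictly positive variance of self-information σ²(X) = E[(−log_K P_X(X) − H(X))²]. Then for every ε with 0 < ε < 1, the infimum (ε, H(X)/α_c)-achievable second-order overflow threshold satisfies L(ε, H(X)/α_c | X) = (1/α_c) · √(σ²(X)) · Φ^{−1}(1 − ε), where Φ(T) = ∫_{−∞}^{T} (1/√(2π)) e^{−y²/2} dy is the standard Gaussian cumulative distribution function and Φ^{−1} its inverse. -/

import Mathlib

open scoped BigOperators

/-- Cost of a string `l` over the code alphabet `Fin K`: the sum of the conditional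
per-symbol costs `c (l.get i) (prefix before position i)`. -/
noncomputable def strCost {K : ℕ} (c : Fin K → List (Fin K) → ℝ) (l : List (Fin K)) : ℝ :=
  ∑ i : Fin l.length, c (l.get i) (l.take i.val)

/-- Probability of the set `S` under the probability mass function `P`. -/
noncomputable def prSet {α : Type*} (P : α → ℝ) (S : Set α) : ℝ :=
  ∑' x, S.indicator P x

/-- The standard Gaussian cumulative distribution function. -/
noncomputable def stdGaussCDF (T : ℝ) : ℝ :=
  ∫ y in Set.Iic T, (Real.sqrt (2 * Real.pi))⁻¹ * Real.exp (-(y ^ 2) / 2)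

/-- Inverse of the standard Gaussian cumulative distribution function. -/
noncomputable def stdGaussCDFInv : ℝ → ℝ := Function.invFun stdGaussCDF


open MeasureTheory ProbabilityTheory Filter Topology

/-! ### The Gaussian distribution function -/

lemma stdGaussCDF_eq_real (T : ℝ) : stdGaussCDF T = (gaussianReal 0 1).real (Set.Iic T) := by
  rw [measureReal_def, gaussianReal_apply_eq_integral 0 one_ne_zero, ENNReal.toReal_ofReal]
  · simp [stdGaussCDF, gaussianPDFReal]
  · exact integral_nonneg fun x ↦ gaussianPDFReal_nonneg 0 1 x

lemma stdGaussCDF_strictMono : StrictMono stdGaussCDF := by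
  intro a b hab
  have hpos : 0 < (gaussianReal 0 1) (Set.Ioc a b) := by
    rw [pos_iff_ne_zero]
    intro h
    have := gaussianReal_absolutelyContinuous' 0 one_ne_zero h
    simp [hab.not_ge] at this
  rw [stdGaussCDF_eq_real, stdGaussCDF_eq_real, ← Set.Iic_union_Ioc_eq_Iic hab.le,
    measureReal_union (Set.Iic_disjoint_Ioc le_rfl) measurableSet_Ioc]
  linarith [show 0 < (gaussianReal 0 1).real (Set.Ioc a b) from
    ENNReal.toReal_pos hpos.ne' (measure_ne_top _ _)]

lemma stdGaussCDF_continuous : Continuous stdGaussCDF := by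
  have : IntegrableOn (fun y : ℝ ↦ (Real.sqrt (2 * Real.pi))⁻¹ * Real.exp (-(y ^ 2) / 2))
      Set.univ := by
    have := integrable_gaussianPDFReal 0 1
    simpa [gaussianPDFReal_def] using this
  refine continuous_iff_continuousAt.2 fun a ↦ ?_
  have h (T : ℝ) : stdGaussCDF T = stdGaussCDF 0 +
      ∫ y in (0 : ℝ)..T, (Real.sqrt (2 * Real.pi))⁻¹ * Real.exp (-(y ^ 2) / 2) := by
    have := intervalIntegral.integral_Iic_sub_Iic (a := 0) (b := T)
      (this.mono_set (Set.subset_univ _)) (this.mono_set (Set.subset_univ _))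
    rw [← this, stdGaussCDF, stdGaussCDF]
    ring
  rw [show stdGaussCDF = _ from funext h]
  refine (continuous_const.add (intervalIntegral.continuous_primitive (fun a b ↦ ?_) 0)).continuousAt
  exact (Continuous.intervalIntegrable (by fun_prop) _ _)

lemma stdGaussCDF_stdGaussCDFInv {q : ℝ} (h0 : 0 < q) (h1 : q < 1) :
    stdGaussCDF (stdGaussCDFInv q) = q := by
  have heq : stdGaussCDF = cdf (gaussianReal 0 1) := by
    ext T
    rw [stdGaussCDF_eq_real, cdf_eq_real]
  refine Function.invFun_eq ?_
  obtain ⟨a, ha⟩ := ((tendsto_cdf_atBot (gaussianReal 0 1)).eventually_lt_const h0).exists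
  obtain ⟨b, hb⟩ := ((tendsto_cdf_atTop (gaussianReal 0 1)).eventually_const_lt h1).exists
  exact mem_range_of_exists_le_of_exists_ge stdGaussCDF_continuous
    ⟨a, by rw [heq]; exact ha.le⟩ ⟨b, by rw [heq]; exact hb.le⟩

/-! ### Discrete probabilities -/

lemma prSet_eq_measureReal {α : Type*} [Countable α] [MeasurableSpace α]
    [MeasurableSingletonClass α] (ν : Measure α) [IsFiniteMeasure ν] {P : α → ℝ}
    (hP : ∀ x, ν.real {x} = P x) (S : Set α) : prSet P S = ν.real S := by
  rw [measureReal_def, ← ν.tsum_indicator_apply_singleton S S.to_countable.measurableSet,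
    ENNReal.tsum_toReal_eq]
  · refine tsum_congr fun x ↦ ?_
    by_cases hx : x ∈ S
    · simp [hx, ← hP, measureReal_def]
    · simp [hx]
  · intro x
    by_cases hx : x ∈ S <;> simp [hx]

lemma prSet_mono {α : Type*} {P : α → ℝ} (h0 : ∀ x, 0 ≤ P x) (hs : Summable P) {S T : Set α}
    (h : ∀ x ∈ S, 0 < P x → x ∈ T) : prSet P S ≤ prSet P T := by
  refine (hs.indicator S).tsum_le_tsum (fun x ↦ ?_) (hs.indicator T)
  rcases (h0 x).eq_or_lt with hx | hx
  · simp [Set.indicator, ← hx]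
  · by_cases hS : x ∈ S
    · simp [hS, h x hS hx]
    · simpa [hS] using Set.indicator_nonneg (fun x _ ↦ h0 x) x

/-- The probability measure on a countable type with given point masses. -/
lemma exists_probabilityMeasure_real_singleton {α : Type*} [Countable α] [MeasurableSpace α]
    [MeasurableSingletonClass α] {p : α → ℝ} (hp : ∀ x, 0 ≤ p x) (hpsum : HasSum p 1) :
    ∃ μ : Measure α, IsProbabilityMeasure μ ∧ ∀ x, μ.real {x} = p x := by
  have hsum : HasSum (fun x ↦ ENNReal.ofReal (p x)) 1 := by
    rw [← ENNReal.ofReal_one, ← hpsum.tsum_eq, ENNReal.ofReal_tsum_of_nonneg hp hpsum.summable]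
    exact ENNReal.summable.hasSum
  let q : PMF α := ⟨_, hsum⟩
  refine ⟨q.toMeasure, inferInstance, fun x ↦ ?_⟩
  rw [measureReal_def, q.toMeasure_apply_singleton x (measurableSet_singleton x)]
  exact ENNReal.toReal_ofReal (hp x)

lemma integrable_and_integral_of_hasSum {α : Type*} [Countable α] [MeasurableSpace α]
    [MeasurableSingletonClass α] {μ : Measure α} [IsFiniteMeasure μ] {f : α → ℝ} {s : ℝ}
    (h : HasSum (fun x ↦ μ.real {x} * f x) s) : Integrable f μ ∧ ∫ x, f x ∂μ = s := by
  have hint : Integrable f μ := by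
    refine ⟨(measurable_of_countable f).aestronglyMeasurable, ?_⟩
    rw [HasFiniteIntegral, lintegral_countable']
    have hs := h.summable.abs
    have : (fun x ↦ ‖f x‖ₑ * μ {x}) = fun x ↦ ENNReal.ofReal |μ.real {x} * f x| := by
      ext x
      rw [abs_mul, abs_of_nonneg measureReal_nonneg, ENNReal.ofReal_mul measureReal_nonneg,
        ofReal_measureReal, mul_comm, Real.enorm_eq_ofReal_abs]
    rw [this, ← ENNReal.ofReal_tsum_of_nonneg (fun _ ↦ abs_nonneg _) hs]
    exact ENNReal.ofReal_lt_top
  refine ⟨hint, ?_⟩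
  rw [integral_countable hint]
  exact h.tsum_eq

lemma measureReal_pi_singleton {α : Type*} [MeasurableSpace α] {μ : Measure α}
    [IsProbabilityMeasure μ] {n : ℕ} (x : Fin n → α) :
    (Measure.pi fun _ : Fin n ↦ μ).real {x} = ∏ i, μ.real {x i} := by
  simp [measureReal_def, Measure.pi_singleton, ENNReal.toReal_prod]

lemma hasSum_prod_pi_one {α : Type*} [Countable α] {p : α → ℝ} (hp : ∀ x, 0 ≤ p x)
    (hpsum : HasSum p 1) (n : ℕ) : HasSum (fun x : Fin n → α ↦ ∏ i, p (x i)) 1 := by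
  let : MeasurableSpace α := ⊤
  obtain ⟨μ, hμ, hμp⟩ := exists_probabilityMeasure_real_singleton hp hpsum
  have h := prSet_eq_measureReal (Measure.pi fun _ : Fin n ↦ μ) measureReal_pi_singleton Set.univ
  simp only [prSet, Set.indicator_univ, probReal_univ, hμp] at h
  rw [← h]
  exact Summable.hasSum (by_contra fun hs ↦ by simp [tsum_eq_zero_of_not_summable hs] at h)

/-- **Central limit theorem** for sums of a function of the letters of a discrete i.i.d. source. -/
lemma tendsto_prSet_lt_sum {α : Type*} [Countable α] {p : α → ℝ} (hp : ∀ x, 0 ≤ p x)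
    (hpsum : HasSum p 1) {f : α → ℝ} {m v : ℝ} (hm : HasSum (fun x ↦ p x * f x) m)
    (hv : HasSum (fun x ↦ p x * (f x - m) ^ 2) v) (hvpos : 0 < v) (T : ℝ) :
    Tendsto (fun n : ℕ ↦ prSet (fun x : Fin n → α ↦ ∏ i, p (x i))
      {x | n * m + T * √n < ∑ i, f (x i)}) atTop (𝓝 (1 - stdGaussCDF (T / √v))) := by
  let : MeasurableSpace α := ⊤
  obtain ⟨μ, hμ, hμp⟩ := exists_probabilityMeasure_real_singleton hp hpsum
  have hsv : 0 < √v := Real.sqrt_pos.2 hvpos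
  let g : α → ℝ := fun x ↦ (f x - m) / √v
  have hg : Measurable g := measurable_of_countable g
  have h0 : ∫ x, g x ∂μ = 0 := by
    refine (integrable_and_integral_of_hasSum ?_).2
    have := (hm.sub (hpsum.mul_right m)).div_const √v
    simp only [hμp]
    convert! this using 2
    · simp only [g]; ring
    · simp
  have h1 : ∫ x, g x ^ 2 ∂μ = 1 := by
    refine (integrable_and_integral_of_hasSum ?_).2
    have := hv.div_const v
    rw [div_self hvpos.ne'] at this
    simp only [hμp]
    convert! this using 2
    simp only [g]
    rw [div_pow, Real.sq_sqrt hvpos.le, mul_div_assoc]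
  let Q : Measure (ℕ → α) := Measure.infinitePi fun _ ↦ μ
  let X : ℕ → (ℕ → α) → ℝ := fun k ω ↦ g (ω k)
  have hlaw (k : ℕ) : MeasurePreserving (fun ω : ℕ → α ↦ ω k) Q μ :=
    measurePreserving_eval_infinitePi (fun _ ↦ μ) k
  have hindep : iIndepFun X Q := iIndepFun_infinitePi (X := fun _ ↦ g) fun _ ↦ hg
  have hident (k : ℕ) : IdentDistrib (X k) (X 0) Q Q :=
    IdentDistrib.comp (u := g) ⟨(hlaw k).aemeasurable, (hlaw 0).aemeasurable,
      (hlaw k).map_eq.trans (hlaw 0).map_eq.symm⟩ hg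
  have hint (u : α → ℝ) (hu : Measurable u) : ∫ ω, u (ω 0) ∂Q = ∫ x, u x ∂μ := by
    rw [← (hlaw 0).map_eq, integral_map (hlaw 0).aemeasurable hu.aestronglyMeasurable]
  have hclt := (tendstoInDistribution_inv_sqrt_mul_sum (Y := id) (P' := gaussianReal 0 1)
    HasLaw.id ((hint g hg).trans h0) ((hint (fun x ↦ g x ^ 2) (hg.pow_const 2)).trans h1)
    hindep hident).tendsto
  have hnull : (gaussianReal 0 1) (frontier (Set.Ioi (T / √v))) = 0 := by
    rw [frontier_Ioi]
    exact (nullSingletonClass_gaussianReal one_ne_zero).measure_singleton _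
  have hconv := ProbabilityMeasure.tendsto_measure_of_null_frontier_of_tendsto' hclt
    (E := Set.Ioi (T / √v)) (by simpa using hnull)
  have hlim : 1 - stdGaussCDF (T / √v) = (gaussianReal 0 1).real (Set.Ioi (T / √v)) := by
    rw [stdGaussCDF_eq_real, ← Set.compl_Iic, probReal_compl_eq_one_sub measurableSet_Iic]
  rw [hlim]
  simp only [ProbabilityMeasure.coe_mk, Measure.map_id] at hconv
  refine ((ENNReal.tendsto_toReal (measure_ne_top _ _)).comp hconv).congr' ?_
  filter_upwards [eventually_gt_atTop 0] with n hn
  have hsn : 0 < √(n : ℝ) := Real.sqrt_pos.2 (by exact_mod_cast hn)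
  rw [prSet_eq_measureReal (Measure.pi fun _ : Fin n ↦ μ)
    (fun x ↦ by simp_rw [measureReal_pi_singleton, hμp])]
  have hmap : Q.map (fun ω (i : Fin n) ↦ ω i) = Measure.pi fun _ : Fin n ↦ μ := by
    rw [← Measure.infinitePi_eq_pi]
    exact Measure.map_infinitePi_infinitePi_of_inj (P := fun _ : ℕ ↦ μ) Fin.val_injective
  rw [← hmap, map_measureReal_apply (by fun_prop) (Set.to_countable _).measurableSet]
  simp only [Function.comp_apply]
  rw [Measure.map_apply (by fun_prop) measurableSet_Ioi, measureReal_def]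
  congr 2
  ext ω
  simp only [Set.mem_preimage, Set.mem_Ioi, Set.mem_ofPred_eq, X, g]
  rw [← Finset.sum_div, Finset.sum_sub_distrib, Finset.sum_const, Finset.card_range, nsmul_eq_mul,
    ← Fin.sum_univ_eq_sum_range (fun k ↦ f (ω k)), ← mul_div_assoc, div_lt_div_iff_of_pos_right hsv,
    inv_mul_eq_div, lt_div_iff₀ hsn, lt_sub_iff_add_lt, add_comm]

/-! ### Codes -/

lemma strCost_append_singleton {K : ℕ} (c : Fin K → List (Fin K) → ℝ) (l : List (Fin K))
    (u : Fin K) : strCost c (l ++ [u]) = strCost c l + c u l := by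
  have h : l.length + 1 = (l ++ [u]).length := by simp
  unfold strCost
  rw [← (finCongr h).sum_comp, Fin.sum_univ_castSucc]
  congr 1
  · refine Finset.sum_congr rfl fun i _ ↦ ?_
    simp [List.take_append_of_le_length i.2.le]
  · simp

section Code

variable {K : ℕ} {c : Fin K → List (Fin K) → ℝ} {cmax α : ℝ}

lemma exists_pos_forall_le_cost (hK : 2 ≤ K) (hcpos : ∀ u s, 0 < c u s)
    (hcmax : ∀ u s, c u s ≤ cmax) (hα : 0 < α)
    (hcap : ∀ s, ∑ u : Fin K, (K : ℝ) ^ (-(α * c u s)) = 1) :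
    ∃ b, 0 < b ∧ ∀ u s, b ≤ α * c u s := by
  have hK1 : (1 : ℝ) < K := by exact_mod_cast hK
  have hK0 : (0 : ℝ) < K := by linarith
  have : Nontrivial (Fin K) := Fin.nontrivial_iff_two_le.2 hK
  let u₀ : Fin K := ⟨0, by omega⟩
  have hcmax0 : 0 < cmax := (hcpos u₀ []).trans_le (hcmax u₀ [])
  have hδ0 : 0 < (K : ℝ) ^ (-(α * cmax)) := Real.rpow_pos_of_pos hK0 _
  have hδ1 : (K : ℝ) ^ (-(α * cmax)) < 1 :=
    Real.rpow_lt_one_of_one_lt_of_neg hK1 (neg_lt_zero.2 (by positivity))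
  refine ⟨-Real.logb K (1 - (K : ℝ) ^ (-(α * cmax))), ?_, fun u s ↦ ?_⟩
  · exact neg_pos.2 (Real.logb_neg hK1 (by linarith) (by linarith))
  · obtain ⟨v, hv⟩ := exists_ne u
    have hle : (K : ℝ) ^ (-(α * cmax)) ≤ (K : ℝ) ^ (-(α * c v s)) :=
      Real.rpow_le_rpow_of_exponent_le hK1.le
        (neg_le_neg (mul_le_mul_of_nonneg_left (hcmax v s) hα.le))
    have hsum : (K : ℝ) ^ (-(α * c u s)) + (K : ℝ) ^ (-(α * c v s)) ≤ 1 := by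
      rw [← hcap s, ← Finset.sum_pair (f := fun u ↦ (K : ℝ) ^ (-(α * c u s))) hv.symm]
      exact Finset.sum_le_sum_of_subset_of_nonneg (Finset.subset_univ _)
        fun _ _ _ ↦ (Real.rpow_pos_of_pos hK0 _).le
    have := (Real.le_logb_iff_rpow_le hK1 (by linarith)).2
      (show (K : ℝ) ^ (-(α * c u s)) ≤ 1 - (K : ℝ) ^ (-(α * cmax)) by linarith)
    linarith

lemma exists_string_cost_mem_Icc (hK : 2 ≤ K) (hcpos : ∀ u s, 0 < c u s)
    (hcmax : ∀ u s, c u s ≤ cmax) (hα : 0 < α)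
    (hcap : ∀ s, ∑ u : Fin K, (K : ℝ) ^ (-(α * c u s)) = 1) {t : ℝ} (ht : 0 ≤ t) :
    ∃ l : List (Fin K), l ≠ [] ∧ α * strCost c l ∈ Set.Icc t (t + α * cmax) := by
  obtain ⟨b, hb, hbc⟩ := exists_pos_forall_le_cost hK hcpos hcmax hα hcap
  let u : Fin K := ⟨0, by omega⟩
  let w : ℕ → ℝ := fun m ↦ α * strCost c (List.replicate m u)
  have hsucc (m : ℕ) : w (m + 1) = w m + α * c u (List.replicate m u) := by
    simp only [w, List.replicate_succ', strCost_append_singleton]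
    ring
  have h0 : w 0 = 0 := by simp [w, strCost]
  have hge (m : ℕ) : m * b ≤ w m := by
    induction m with
    | zero => simp [h0]
    | succ m ih => rw [hsucc]; push_cast; linarith [hbc u (List.replicate m u)]
  have hex : ∃ m, t ≤ w (m + 1) := by
    obtain ⟨m, hm⟩ := exists_nat_ge (t / b)
    refine ⟨m, le_trans ?_ (hge (m + 1))⟩
    rw [div_le_iff₀ hb] at hm
    push_cast
    linarith
  classical
  refine ⟨List.replicate (Nat.find hex + 1) u, by simp, Nat.find_spec hex, ?_⟩
  have hprev : w (Nat.find hex) ≤ t := by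
    rcases hm : Nat.find hex with _ | m
    · rw [h0]; exact ht
    · exact (not_le.1 (Nat.find_min hex (by omega : m < Nat.find hex))).le
  have := hsucc (Nat.find hex)
  have := mul_le_mul_of_nonneg_left (hcmax u (List.replicate (Nat.find hex) u)) hα.le
  change w (Nat.find hex + 1) ≤ _
  linarith

/-- Every distribution on a countable set has a code satisfying the cost Kraft inequality whose
normalized costs exceed the self-information by at most a constant. -/
lemma exists_code_cost_le (hK : 2 ≤ K) (hcpos : ∀ u s, 0 < c u s)
    (hcmax : ∀ u s, c u s ≤ cmax) (hα : 0 < α)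
    (hcap : ∀ s, ∑ u : Fin K, (K : ℝ) ^ (-(α * c u s)) = 1)
    {β : Type*} [Countable β] {P : β → ℝ} (hP : ∀ x, 0 ≤ P x) (hPsum : HasSum P 1) :
    ∃ φ : β → List (Fin K), (∀ x, φ x ≠ []) ∧
      (∑' x, ENNReal.ofReal ((K : ℝ) ^ (-(α * strCost c (φ x)))) ≤ 1) ∧
      ∀ x, 0 < P x →
        α * strCost c (φ x) ≤ -Real.logb K (P x) + (Real.logb K 2 + α * cmax) := by
  have hK1 : (1 : ℝ) < K := by exact_mod_cast hK
  have hK0 : (0 : ℝ) < K := by linarith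
  obtain ⟨R, hR0, r, hR, hr⟩ := NNReal.exists_pos_sum_of_countable (one_ne_zero (α := NNReal)) β
  have hRsum : HasSum (fun x ↦ (R x : ℝ)) r := by exact_mod_cast hR
  have hr1 : (r : ℝ) < 1 := by exact_mod_cast hr
  let Q : β → ℝ := fun x ↦ (P x + R x) / 2
  have hQ0 (x : β) : 0 < Q x := by
    have : (0 : ℝ) < R x := by exact_mod_cast hR0 x
    have := hP x
    simp only [Q]
    linarith
  have hQsum : HasSum Q ((1 + r) / 2) := (hPsum.add hRsum).div_const 2
  have hQ1 (x : β) : Q x ≤ 1 :=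
    (le_hasSum hQsum x fun y _ ↦ (hQ0 y).le).trans (by linarith)
  choose φ hne hφ using fun x ↦ exists_string_cost_mem_Icc hK hcpos hcmax hα hcap
    (neg_nonneg.2 (Real.logb_nonpos hK1 (hQ0 x).le (hQ1 x)))
  refine ⟨φ, hne, ?_, fun x hx ↦ (hφ x).2.trans ?_⟩
  · calc ∑' x, ENNReal.ofReal ((K : ℝ) ^ (-(α * strCost c (φ x))))
        ≤ ∑' x, ENNReal.ofReal (Q x) := by
          refine ENNReal.tsum_le_tsum fun x ↦ ENNReal.ofReal_le_ofReal ?_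
          rw [← Real.le_logb_iff_rpow_le hK1 (hQ0 x)]
          linarith [(hφ x).1]
      _ = ENNReal.ofReal ((1 + r) / 2) := by
          rw [← ENNReal.ofReal_tsum_of_nonneg (fun x ↦ (hQ0 x).le) hQsum.summable, hQsum.tsum_eq]
      _ ≤ 1 := ENNReal.ofReal_le_one.2 (by linarith)
  · have hle : P x / 2 ≤ Q x :=
      div_le_div_of_nonneg_right (le_add_of_nonneg_right (R x).2) zero_le_two
    have := Real.logb_le_logb_of_le hK1 (by positivity) hle
    rw [Real.logb_div hx.ne' two_ne_zero] at this
    linarith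

/-- Under the Kraft inequality, the self-information exceeds the normalized cost by more than `γ`
with probability at most `K ^ (-γ)`. -/
lemma prSet_lt_selfInfo_le (hK : 2 ≤ K) {β : Type*} {P : β → ℝ} (hP : ∀ x, 0 ≤ P x)
    (hPsum : Summable P) {w : β → ℝ} (hw : ∑' x, ENNReal.ofReal ((K : ℝ) ^ (-(w x))) ≤ 1)
    (η γ : ℝ) : prSet P {x | η + γ < -Real.logb K (P x)} ≤
      prSet P {x | η < w x} + (K : ℝ) ^ (-γ) := by
  have hK1 : (1 : ℝ) < K := by exact_mod_cast hK
  have hK0 : (0 : ℝ) < K := by linarith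
  have hw0 (x : β) : 0 ≤ (K : ℝ) ^ (-(w x)) := (Real.rpow_pos_of_pos hK0 _).le
  have hws : Summable fun x ↦ (K : ℝ) ^ (-(w x)) := by
    refine (ENNReal.summable_toReal (hw.trans_lt ENNReal.one_lt_top).ne).congr fun x ↦ ?_
    rw [ENNReal.toReal_ofReal (hw0 x)]
  have hw1 : ∑' x, (K : ℝ) ^ (-(w x)) ≤ 1 := by
    rwa [← ENNReal.ofReal_tsum_of_nonneg hw0 hws, ENNReal.ofReal_le_one] at hw
  calc prSet P {x | η + γ < -Real.logb K (P x)}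
      ≤ ∑' x, ({x | η < w x}.indicator P x + (K : ℝ) ^ (-γ) * (K : ℝ) ^ (-(w x))) := by
        refine (hPsum.indicator _).tsum_le_tsum (fun x ↦ ?_)
          ((hPsum.indicator _).add (hws.mul_left _))
        have hr : 0 ≤ (K : ℝ) ^ (-γ) * (K : ℝ) ^ (-(w x)) :=
          mul_nonneg (Real.rpow_pos_of_pos hK0 _).le (hw0 x)
        have hi := Set.indicator_nonneg (s := {x | η < w x}) (fun x _ ↦ hP x) x
        by_cases hA : x ∈ {x | η + γ < -Real.logb K (P x)}
        · by_cases hB : x ∈ {x | η < w x}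
          · simpa [Set.indicator_of_mem hA, Set.indicator_of_mem hB] using hr
          · rw [Set.indicator_of_mem hA, Set.indicator_of_notMem hB, zero_add]
            rcases (hP x).eq_or_lt with h0 | h0
            · rwa [← h0]
            · rw [← Real.rpow_add hK0, ← Real.logb_le_iff_le_rpow hK1 h0]
              simp only [Set.mem_ofPred_eq, not_lt] at hA hB
              linarith
        · rw [Set.indicator_of_notMem hA]
          exact add_nonneg hi hr
    _ = prSet P {x | η < w x} + (K : ℝ) ^ (-γ) * ∑' x, (K : ℝ) ^ (-(w x)) := by
        rw [(hPsum.indicator _).tsum_add (hws.mul_left _), tsum_mul_left, prSet]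
    _ ≤ _ := by
        have := mul_le_mul_of_nonneg_left hw1 (Real.rpow_pos_of_pos hK0 (-γ)).le
        linarith

end Code

lemma neg_logb_prod_eq_sum {ι : Type*} [Fintype ι] (b : ℝ) {q : ι → ℝ} (h : ∏ i, q i ≠ 0) :
    -Real.logb b (∏ i, q i) = ∑ i, -Real.logb b (q i) := by
  rw [Real.logb_prod _ _ fun i hi ↦ Finset.prod_ne_zero_iff.1 h i hi, Finset.sum_neg_distrib]

/-- Theorem 3: for an i.i.d. source with finite entropy `H` and finite positive variance
of self-information `σ²`, the infimum `(ε, H/αc)`-achievable second-order overflow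
threshold equals `(1/αc) · √σ² · Φ⁻¹(1 − ε)`. -/
theorem second_order_overflow_threshold_iid
    (K : ℕ) (hK : 2 ≤ K)
    (c : Fin K → List (Fin K) → ℝ) (cmax αc : ℝ)
    (hcpos : ∀ (u : Fin K) (s : List (Fin K)), 0 < c u s)
    (hcmax : ∀ (u : Fin K) (s : List (Fin K)), c u s ≤ cmax)
    (hαc : 0 < αc)
    (hcap : ∀ s : List (Fin K), ∑ u : Fin K, (K : ℝ) ^ (-(αc * c u s)) = 1)
    (𝓧 : Type) [Countable 𝓧]
    (p : 𝓧 → ℝ) (hp : ∀ x, 0 ≤ p x) (hpsum : HasSum p 1)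
    (H σ2 : ℝ)
    (hH : HasSum (fun x => p x * (-(Real.logb K (p x)))) H)
    (hσ2 : HasSum (fun x => p x * (-(Real.logb K (p x)) - H) ^ 2) σ2)
    (hσ2pos : 0 < σ2)
    (ε : ℝ) (hε0 : 0 < ε) (hε1 : ε < 1) :
    sInf {L : ℝ | ∃ φ : (n : ℕ) → (Fin n → 𝓧) → List (Fin K),
        (∀ n x, φ n x ≠ []) ∧
        (∀ n, ∑' x, ENNReal.ofReal ((K : ℝ) ^ (-(αc * strCost c (φ n x)))) ≤ 1) ∧
        Filter.limsup
          (fun n => prSet (fun x : Fin n → 𝓧 => ∏ i, p (x i))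
            {x | strCost c (φ n x) > (n : ℝ) * (H / αc) + L * Real.sqrt n})
          Filter.atTop ≤ ε}
    = (1 / αc) * Real.sqrt σ2 * stdGaussCDFInv (1 - ε) := by
  have hK1 : (1 : ℝ) < K := by exact_mod_cast hK
  have hsσ : 0 < √σ2 := Real.sqrt_pos.2 hσ2pos
  have hΦ := stdGaussCDF_stdGaussCDFInv (sub_pos.2 hε1) (sub_lt_self 1 hε0)
  have hP0 (n : ℕ) (x : Fin n → 𝓧) : 0 ≤ ∏ i, p (x i) := Finset.prod_nonneg fun i _ ↦ hp _
  have hPsum := hasSum_prod_pi_one hp hpsum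
  have hclt := tendsto_prSet_lt_sum hp hpsum hH hσ2 hσ2pos
  have hLs : αc * ((1 / αc) * √σ2 * stdGaussCDFInv (1 - ε)) = √σ2 * stdGaussCDFInv (1 - ε) := by
    field_simp
  have hscale (φ : (n : ℕ) → (Fin n → 𝓧) → List (Fin K)) (L : ℝ) (n : ℕ) :
      {x | strCost c (φ n x) > (n : ℝ) * (H / αc) + L * √n} =
        {x | n * H + αc * L * √n < αc * strCost c (φ n x)} := by
    ext x
    rw [Set.mem_ofPred_eq, Set.mem_ofPred_eq, gt_iff_lt, ← mul_lt_mul_iff_right₀ hαc]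
    have : αc * ((n : ℝ) * (H / αc) + L * √n) = n * H + αc * L * √n := by field_simp
    rw [this]
  have hF0 (n : ℕ) (S : Set (Fin n → 𝓧)) : 0 ≤ prSet (fun x ↦ ∏ i, p (x i)) S :=
    tsum_nonneg (Set.indicator_nonneg fun x _ ↦ hP0 n x)
  have hF1 (n : ℕ) (S : Set (Fin n → 𝓧)) : prSet (fun x ↦ ∏ i, p (x i)) S ≤ 1 := by
    refine (prSet_mono (hP0 n) (hPsum n).summable fun x _ _ ↦ Set.mem_univ x).trans_eq ?_
    simp [prSet, (hPsum n).tsum_eq]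
  have hsqrt : Tendsto (fun n : ℕ ↦ √(n : ℝ)) atTop atTop :=
    Real.tendsto_sqrt_atTop.comp tendsto_natCast_atTop_atTop
  have hachievable (L : ℝ) (hL : (1 / αc) * √σ2 * stdGaussCDFInv (1 - ε) < L) :
      ∃ φ : (n : ℕ) → (Fin n → 𝓧) → List (Fin K),
        (∀ n x, φ n x ≠ []) ∧
        (∀ n, ∑' x, ENNReal.ofReal ((K : ℝ) ^ (-(αc * strCost c (φ n x)))) ≤ 1) ∧
        Filter.limsup
          (fun n => prSet (fun x : Fin n → 𝓧 => ∏ i, p (x i))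
            {x | strCost c (φ n x) > (n : ℝ) * (H / αc) + L * Real.sqrt n})
          Filter.atTop ≤ ε := by
    choose φ hne hkraft hφ using fun n : ℕ ↦
      exists_code_cost_le hK hcpos hcmax hαc hcap (hP0 n) (hPsum n)
    refine ⟨φ, hne, hkraft, ?_⟩
    obtain ⟨T, hT, hTL⟩ := exists_between (mul_lt_mul_of_pos_left hL hαc)
    rw [hLs, ← lt_div_iff₀' hsσ] at hT
    have hlt := stdGaussCDF_strictMono hT
    rw [hΦ] at hlt
    refine le_trans ?_ (show 1 - stdGaussCDF (T / √σ2) ≤ ε by linarith)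
    rw [← (hclt T).limsup_eq]
    refine limsup_le_limsup ?_ (isCoboundedUnder_le_of_le atTop fun n ↦ hF0 n _)
      (isBoundedUnder_of ⟨1, fun n ↦ hF1 n _⟩)
    filter_upwards [(hsqrt.const_mul_atTop (sub_pos.2 hTL)).eventually_ge_atTop
      (Real.logb K 2 + αc * cmax)] with n hn
    rw [hscale]
    refine prSet_mono (hP0 n) (hPsum n).summable fun x hx hx0 ↦ ?_
    have := hφ n x hx0
    rw [neg_logb_prod_eq_sum _ hx0.ne'] at this
    simp only [Set.mem_ofPred_eq] at hx ⊢
    linarith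
  refine csInf_eq_of_forall_ge_of_forall_gt_exists_lt ?_ ?_ ?_
  · exact ⟨_, hachievable _ (lt_add_one _)⟩
  · rintro L ⟨φ, -, hkraft, hlim⟩
    by_contra! hL
    obtain ⟨T, hTL, hT⟩ := exists_between (mul_lt_mul_of_pos_left hL hαc)
    rw [hLs, ← div_lt_iff₀' hsσ] at hT
    have hlt := stdGaussCDF_strictMono hT
    rw [hΦ] at hlt
    have hsmall : Tendsto (fun n : ℕ ↦ (K : ℝ) ^ (-((T - αc * L) * √n))) atTop (𝓝 0) :=
      (tendsto_rpow_atBot_of_base_gt_one _ hK1).comp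
        (tendsto_neg_atTop_atBot.comp (hsqrt.const_mul_atTop (sub_pos.2 hTL)))
    have hlower := (hclt T).sub hsmall
    rw [sub_zero] at hlower
    refine (hlower.limsup_eq.symm.trans_le (limsup_le_limsup ?_
      hlower.isCoboundedUnder_le (isBoundedUnder_of ⟨1, fun n ↦ hF1 n _⟩))).not_gt
      (hlim.trans_lt (by linarith))
    refine Eventually.of_forall fun n ↦ ?_
    beta_reduce
    rw [hscale]
    have hconv := prSet_lt_selfInfo_le hK (hP0 n) (hPsum n).summable (hkraft n)
      (n * H + αc * L * √n) ((T - αc * L) * √n)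
    refine sub_le_iff_le_add.2 (le_trans ?_ hconv)
    refine prSet_mono (hP0 n) (hPsum n).summable fun x hx hx0 ↦ ?_
    simp only [Set.mem_ofPred_eq] at hx ⊢
    rw [neg_logb_prod_eq_sum _ hx0.ne']
    linarith
  · intro L hL
    obtain ⟨L', hL', hLL'⟩ := exists_between hL
    exact ⟨L', hachievable L' hL', hLL'⟩
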